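/- arXiv:2112.11882 — 2 statements merged into one kernel-verified Lean document; each statement's English description precedes it below -/
import Mathlib

section
/- φ(e^{−7π√7}) = 7^{−3/4} φ(e^{−π√7}) · {1 + (cos(π/7)/(2cos²(2π/7)))^{2/7} + (cos(2π/7)/(2cos²(3π/7)))^{2/7} + (cos(3π/7)/(2cos²(π/7)))^{2/7}}, where φ(q) = ∑_{n ∈ ℤ} q^{n²}. -/
open Real

/-- Ramanujan's theta function `φ(q) = ∑_{n ∈ ℤ} q^{n²}`. -/
noncomputable def phi (q : ℝ) : ℝ := ∑' n : ℤ, q ^ (n.natAbs ^ 2)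

/-- The partial theta sum `∑ exp(-t m²)` over the integers `m ≡ j (mod 7)`. -/
noncomputable def thetaMod (t : ℝ) (j : ℤ) : ℝ := ∑' n : ℤ, rexp (-t * (7 * n + j) ^ 2)

/-- The theta sum `∑ ζ^(jn) exp(-7tn²)`. -/
noncomputable def thetaTwist (t : ℝ) (ζ : ℂ) (j : ℤ) : ℂ :=
  ∑' n : ℤ, ζ ^ (j * n) * (rexp (-t * (7 * n ^ 2)) : ℂ)

lemma summable_exp_neg_sq {t : ℝ} (ht : 0 < t) :
    Summable fun n : ℤ => rexp (-t * (n : ℝ) ^ 2) := by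
  have h := (summable_jacobiTheta₂_term_iff 0 (Complex.I * (t / π : ℝ))).2 (by
    simp; positivity)
  refine h.norm.congr fun n => ?_
  rw [norm_jacobiTheta₂_term]
  congr 1
  simp
  field_simp

lemma summable_thetaMod {t : ℝ} (ht : 0 < t) (j : ℤ) :
    Summable fun n : ℤ => rexp (-t * (7 * n + j) ^ 2) := by
  have hinj : Function.Injective fun n : ℤ => 7 * n + j := fun a b h => by
    simp only at h; omega
  refine ((summable_exp_neg_sq ht).comp_injective hinj).congr fun n => ?_
  simp

lemma norm_zpow_eq_one {ζ : ℂ} (hζ : ζ ^ 7 = 1) (m : ℤ) : ‖ζ ^ m‖ = 1 := by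
  rw [norm_zpow, Complex.norm_eq_one_of_pow_eq_one hζ (by norm_num), one_zpow]

lemma summable_norm_thetaTwist {t : ℝ} (ht : 0 < t) {ζ : ℂ} (hζ : ζ ^ 7 = 1) (j : ℤ) :
    Summable fun n : ℤ => ‖ζ ^ (j * n) * (rexp (-t * (7 * n ^ 2)) : ℂ)‖ := by
  have h := summable_exp_neg_sq (t := 7 * t) (by positivity)
  refine h.congr fun n => ?_
  rw [norm_mul, norm_zpow_eq_one hζ, one_mul, Complex.norm_real, Real.norm_eq_abs, Real.abs_exp]
  congr 1
  ring

lemma hasSum_mul_four {f₁ f₂ f₃ f₄ : ℤ → ℂ} (h₁ : Summable fun n => ‖f₁ n‖)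
    (h₂ : Summable fun n => ‖f₂ n‖) (h₃ : Summable fun n => ‖f₃ n‖)
    (h₄ : Summable fun n => ‖f₄ n‖) :
    HasSum (fun x : ℤ × ℤ × ℤ × ℤ => f₁ x.1 * (f₂ x.2.1 * (f₃ x.2.2.1 * f₄ x.2.2.2)))
      ((∑' n, f₁ n) * ((∑' n, f₂ n) * ((∑' n, f₃ n) * ∑' n, f₄ n))) := by
  have h₃₄ := h₃.mul_norm h₄
  have h₂₃₄ := h₂.mul_norm h₃₄
  have h := h₁.mul_norm h₂₃₄
  have e := h.of_norm.hasSum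
  rwa [← tsum_mul_tsum_of_summable_norm h₁ h₂₃₄, ← tsum_mul_tsum_of_summable_norm h₂ h₃₄,
    ← tsum_mul_tsum_of_summable_norm h₃ h₄] at e

/-- The decomposition of `ℤ⁴` into the cosets of the right ideal `(2 - i - j - k)ℤ⁴` of
the Lipschitz quaternions. -/
def quaternionCosetEquiv : (Fin 7 × Fin 7) × (ℤ × ℤ × ℤ × ℤ) ≃ ℤ × ℤ × ℤ × ℤ where
  toFun p :=
    (2 * p.2.1 + p.2.2.1 + p.2.2.2.1 + p.2.2.2.2 + (p.1.1 : ℕ),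
      -p.2.1 + 2 * p.2.2.1 + p.2.2.2.1 - p.2.2.2.2 + (p.1.2 : ℕ),
      -p.2.1 - p.2.2.1 + 2 * p.2.2.2.1 + p.2.2.2.2,
      -p.2.1 + p.2.2.1 - p.2.2.2.1 + 2 * p.2.2.2.2)
  invFun x :=
    ((⟨((x.1 + 5 * x.2.2.1 + 4 * x.2.2.2) % 7).toNat, by omega⟩,
      ⟨((x.2.1 + 4 * x.2.2.1 + 2 * x.2.2.2) % 7).toNat, by omega⟩),
      (2 * x.1 - x.2.1 - x.2.2.1 - x.2.2.2 - (2 * ((x.1 + 5 * x.2.2.1 + 4 * x.2.2.2) % 7)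
        - (x.2.1 + 4 * x.2.2.1 + 2 * x.2.2.2) % 7)) / 7,
      (x.1 + 2 * x.2.1 - x.2.2.1 + x.2.2.2 - ((x.1 + 5 * x.2.2.1 + 4 * x.2.2.2) % 7
        + 2 * ((x.2.1 + 4 * x.2.2.1 + 2 * x.2.2.2) % 7))) / 7,
      (x.1 + x.2.1 + 2 * x.2.2.1 - x.2.2.2 - ((x.1 + 5 * x.2.2.1 + 4 * x.2.2.2) % 7
        + (x.2.1 + 4 * x.2.2.1 + 2 * x.2.2.2) % 7)) / 7,
      (x.1 - x.2.1 + x.2.2.1 + 2 * x.2.2.2 - ((x.1 + 5 * x.2.2.1 + 4 * x.2.2.2) % 7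
        - (x.2.1 + 4 * x.2.2.1 + 2 * x.2.2.2) % 7)) / 7)
  left_inv := by
    rintro ⟨⟨⟨s, hs⟩, ⟨t, ht⟩⟩, a, b, c, d⟩
    simp only [Prod.mk.injEq, Fin.mk.injEq]
    have h₁ : (2 * a + b + c + d + (s : ℤ) + 5 * (-a - b + 2 * c + d)
        + 4 * (-a + b - c + 2 * d)) % 7 = s := by omega
    have h₂ : (-a + 2 * b + c - d + (t : ℤ) + 4 * (-a - b + 2 * c + d)
        + 2 * (-a + b - c + 2 * d)) % 7 = t := by omega
    rw [h₁, h₂]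
    refine ⟨⟨by omega, by omega⟩, by omega, by omega, by omega, by omega⟩
  right_inv := by
    rintro ⟨a, b, c, d⟩
    have h₁ : 0 ≤ (a + 5 * c + 4 * d) % 7 := by omega
    have h₂ : 0 ≤ (b + 4 * c + 2 * d) % 7 := by omega
    simp only [Prod.mk.injEq, Int.toNat_of_nonneg h₁, Int.toNat_of_nonneg h₂]
    obtain ⟨u, hu⟩ : ∃ u, (a + 5 * c + 4 * d) / 7 = u := ⟨_, rfl⟩
    obtain ⟨v, hv⟩ : ∃ v, (b + 4 * c + 2 * d) / 7 = v := ⟨_, rfl⟩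
    have e₁ : (a + 5 * c + 4 * d) % 7 = a + 5 * c + 4 * d - 7 * u := by omega
    have e₂ : (b + 4 * c + 2 * d) % 7 = b + 4 * c + 2 * d - 7 * v := by omega
    rw [e₁, e₂]
    refine ⟨by omega, by omega, by omega, by omega⟩

lemma thetaTwist_mul_four {t : ℝ} (ht : 0 < t) {ζ : ℂ} (hζ : ζ ^ 7 = 1) (j k : ℤ × ℤ × ℤ × ℤ)
    (h₁ : j.1 = 2 * k.1 + k.2.1 + k.2.2.1 + k.2.2.2)
    (h₂ : j.2.1 = -k.1 + 2 * k.2.1 + k.2.2.1 - k.2.2.2)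
    (h₃ : j.2.2.1 = -k.1 - k.2.1 + 2 * k.2.2.1 + k.2.2.2)
    (h₄ : j.2.2.2 = -k.1 + k.2.1 - k.2.2.1 + 2 * k.2.2.2) :
    thetaTwist t ζ j.1 * (thetaTwist t ζ j.2.1 *
      (thetaTwist t ζ j.2.2.1 * thetaTwist t ζ j.2.2.2)) =
    ∑ s : Fin 7 × Fin 7, ζ ^ (j.1 * (s.1 : ℕ) + j.2.1 * (s.2 : ℕ)) *
      ((thetaMod t (2 * (s.1 : ℕ) - (s.2 : ℕ)) * (thetaMod t ((s.1 : ℕ) + 2 * (s.2 : ℕ)) *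
      (thetaMod t ((s.1 : ℕ) + (s.2 : ℕ)) * thetaMod t ((s.1 : ℕ) - (s.2 : ℕ)))) : ℝ) : ℂ) := by
  have hζ0 : ζ ≠ 0 := by rintro rfl; norm_num at hζ
  have hz (m : ℤ) : ζ ^ (7 * m) = 1 := by
    rw [zpow_mul]; norm_cast; rw [hζ, one_zpow]
  have hsum := hasSum_mul_four (summable_norm_thetaTwist ht hζ j.1)
    (summable_norm_thetaTwist ht hζ j.2.1) (summable_norm_thetaTwist ht hζ j.2.2.1)
    (summable_norm_thetaTwist ht hζ j.2.2.2)
  rw [← quaternionCosetEquiv.hasSum_iff] at hsum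
  refine (hsum.prod_fiberwise (g := fun s : Fin 7 × Fin 7 => _) fun s => ?_).unique
    (hasSum_fintype _)
  have hS (i : ℤ) : Summable fun n : ℤ => ‖((rexp (-t * (7 * n + i) ^ 2) : ℝ) : ℂ)‖ := by
    simpa only [Complex.norm_real, Real.norm_eq_abs, Real.abs_exp] using summable_thetaMod ht i
  have key := (hasSum_mul_four (hS (2 * (s.1 : ℕ) - (s.2 : ℕ))) (hS ((s.1 : ℕ) + 2 * (s.2 : ℕ)))
    (hS ((s.1 : ℕ) + (s.2 : ℕ))) (hS ((s.1 : ℕ) - (s.2 : ℕ)))).mul_left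
      (ζ ^ (j.1 * (s.1 : ℕ) + j.2.1 * (s.2 : ℕ)))
  simp only [← Complex.ofReal_tsum, ← Complex.ofReal_mul] at key
  refine HasSum.congr_fun key ?_
  rintro ⟨a, b, c, d⟩
  obtain ⟨⟨u, hu⟩, ⟨v, hv⟩⟩ := s
  have hgather (m₁ m₂ m₃ m₄ : ℤ) (x₁ x₂ x₃ x₄ : ℝ) :
      (ζ ^ m₁ * (rexp x₁ : ℂ)) * ((ζ ^ m₂ * (rexp x₂ : ℂ)) * ((ζ ^ m₃ * (rexp x₃ : ℂ)) *
        (ζ ^ m₄ * (rexp x₄ : ℂ)))) = ζ ^ (m₁ + m₂ + m₃ + m₄) * (rexp (x₁ + x₂ + x₃ + x₄) : ℂ) := by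
    rw [zpow_add₀ hζ0, zpow_add₀ hζ0, zpow_add₀ hζ0]
    simp only [Real.exp_add, Complex.ofReal_mul]
    ring
  simp only [Function.comp, quaternionCosetEquiv, Equiv.coe_fn_mk, hgather]
  rw [← Real.exp_add, ← Real.exp_add, ← Real.exp_add]
  congr 1
  · rw [h₁, h₂, h₃, h₄, ← mul_one (ζ ^ (_ + _ * ((v : ℕ) : ℤ))),
      ← hz (k.1 * a + k.2.1 * b + k.2.2.1 * c + k.2.2.2 * d), ← zpow_add₀ hζ0]
    congr 1
    ring
  · congr 2
    push_cast
    ring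

lemma thetaMod_add_seven (t : ℝ) (j : ℤ) : thetaMod t (j + 7) = thetaMod t j := by
  unfold thetaMod
  rw [← (Equiv.addRight (1 : ℤ)).tsum_eq (fun n : ℤ => rexp (-t * (7 * n + j) ^ 2))]
  refine tsum_congr fun n => ?_
  simp only [Equiv.coe_addRight]
  push_cast
  ring_nf

lemma thetaMod_neg (t : ℝ) (j : ℤ) : thetaMod t (-j) = thetaMod t j := by
  unfold thetaMod
  rw [← (Equiv.neg ℤ).tsum_eq (fun n : ℤ => rexp (-t * (7 * n + j) ^ 2))]
  refine tsum_congr fun n => ?_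
  simp only [Equiv.neg_apply]
  push_cast
  ring_nf

lemma thetaTwist_eq {t : ℝ} (ht : t = π / (7 * √7)) (j : ℤ) :
    thetaTwist t (Complex.exp (2 * π * Complex.I / 7)) j =
      1 / ((1 / √7 : ℝ) : ℂ) ^ (1 / 2 : ℂ) * (thetaMod t j : ℂ) := by
  have h7 : (0 : ℝ) < √7 := by positivity
  have hsq : √7 * √7 = 7 := Real.mul_self_sqrt (by norm_num)
  have hsqc : (√7 : ℂ) * (√7 : ℂ) = 7 := by exact_mod_cast hsq
  have h7c : (√7 : ℂ) ≠ 0 := by exact_mod_cast h7.ne'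
  have h := Complex.tsum_exp_neg_quadratic (a := ((1 / √7 : ℝ) : ℂ))
    (by rw [Complex.ofReal_re]; positivity) (Complex.I * j / 7)
  rw [← thetaMod_neg]
  unfold thetaTwist thetaMod
  rw [Complex.ofReal_tsum]
  convert h using 1
  · refine tsum_congr fun n => ?_
    rw [← Complex.exp_int_mul, Complex.ofReal_exp, ← Complex.exp_add, ht]
    congr 1
    push_cast
    field_simp
    ring
  · congr 1
    refine tsum_congr fun n => ?_
    rw [Complex.ofReal_exp, ht]
    congr 1
    push_cast
    have : Complex.I * (Complex.I * (j : ℂ) / 7) = - j / 7 := by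
      linear_combination (j : ℂ) / 7 * Complex.I_mul_I
    rw [this]
    field_simp
    linear_combination (7 * (n : ℂ) - j) ^ 2 * hsqc

lemma thetaFactor_pow_four : (1 / ((1 / √7 : ℝ) : ℂ) ^ (1 / 2 : ℂ)) ^ 4 = 7 := by
  have hsq : √7 * √7 = 7 := Real.mul_self_sqrt (by norm_num)
  have hsqc : (√7 : ℂ) * (√7 : ℂ) = 7 := by exact_mod_cast hsq
  have h7c : (√7 : ℂ) ≠ 0 := by
    rintro h; rw [h] at hsqc; norm_num at hsqc
  have h2 : (((1 / √7 : ℝ) : ℂ) ^ (1 / 2 : ℂ)) ^ 2 = ((1 / √7 : ℝ) : ℂ) := by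
    rw [one_div (2 : ℂ)]
    exact Complex.cpow_nat_inv_pow _ (by norm_num)
  rw [div_pow, one_pow, show 4 = 2 * 2 by norm_num, pow_mul, h2]
  push_cast
  field_simp
  linear_combination hsqc

lemma thetaMod_eq_of_emod {t : ℝ} {i j : ℤ} (h : i % 7 = j % 7) : thetaMod t i = thetaMod t j := by
  have hp : Function.Periodic (thetaMod t) 7 := thetaMod_add_seven t
  obtain ⟨m, hm⟩ : ∃ m, i = j + m * 7 := ⟨(i - j) / 7, by omega⟩
  rw [hm]
  exact hp.int_mul m j

lemma thetaMod_eq_of_emod_neg {t : ℝ} {i j : ℤ} (h : i % 7 = (-j) % 7) :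
    thetaMod t i = thetaMod t j := by
  rw [← thetaMod_neg t j]
  exact thetaMod_eq_of_emod h

lemma thetaMod_reduce (t : ℝ) :
    thetaMod t 4 = thetaMod t 3 ∧ thetaMod t 5 = thetaMod t 2 ∧
    thetaMod t 6 = thetaMod t 1 ∧ thetaMod t 7 = thetaMod t 0 ∧
    thetaMod t 8 = thetaMod t 1 ∧ thetaMod t 9 = thetaMod t 2 ∧
    thetaMod t 10 = thetaMod t 3 ∧ thetaMod t 11 = thetaMod t 3 ∧
    thetaMod t 12 = thetaMod t 2 ∧ thetaMod t 13 = thetaMod t 1 ∧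
    thetaMod t 14 = thetaMod t 0 ∧ thetaMod t 15 = thetaMod t 1 ∧
    thetaMod t 16 = thetaMod t 2 ∧ thetaMod t 17 = thetaMod t 3 ∧
    thetaMod t 18 = thetaMod t 3 := by
  refine ⟨?_, ?_, ?_, ?_, ?_, ?_, ?_, ?_, ?_, ?_, ?_, ?_, ?_, ?_, ?_⟩ <;>
    first
    | (refine thetaMod_eq_of_emod ?_; decide)
    | (refine thetaMod_eq_of_emod_neg ?_; decide)

lemma sum_pow_eq_zero_of_pow_seven {ζ : ℂ} (hζ : ζ ^ 7 = 1) (hζ1 : ζ ≠ 1) :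
    1 + ζ + ζ ^ 2 + ζ ^ 3 + ζ ^ 4 + ζ ^ 5 + ζ ^ 6 = 0 := by
  refine (mul_eq_zero.1 ?_).resolve_left (sub_ne_zero.2 hζ1)
  linear_combination hζ

lemma thetaMod_relation_zero {t : ℝ} (ht : 0 < t) {ζ : ℂ} (hζ : ζ ^ 7 = 1) {L : ℂ} (hL : L ^ 4 = 7)
    (hB : ∀ j, thetaTwist t ζ j = L * thetaMod t j) :
    7 * thetaMod t 0 ^ 4 = thetaMod t 0 ^ 4 +
      24 * (thetaMod t 0 * thetaMod t 1 * thetaMod t 2 * thetaMod t 3) +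
      8 * (thetaMod t 1 ^ 3 * thetaMod t 2 + thetaMod t 2 ^ 3 * thetaMod t 3 +
        thetaMod t 3 ^ 3 * thetaMod t 1) := by
  have h := thetaTwist_mul_four ht hζ (0, 0, 0, 0) (0, 0, 0, 0) (by norm_num) (by norm_num)
    (by norm_num) (by norm_num)
  simp only [hB, Fintype.sum_prod_type, Fin.sum_univ_seven] at h
  simp [thetaMod_neg, thetaMod_reduce] at h
  rw [← Complex.ofReal_inj]
  push_cast
  linear_combination h - (thetaMod t 0 : ℂ) ^ 4 * hL

lemma thetaMod_relation_mixed {t : ℝ} (ht : 0 < t) {ζ : ℂ} (hζ : ζ ^ 7 = 1) {L : ℂ} (hL : L ^ 4 = 7)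
    (hB : ∀ j, thetaTwist t ζ j = L * thetaMod t j) (hζ1 : ζ ≠ 1) :
    7 * (thetaMod t 0 * thetaMod t 1 * thetaMod t 2 * thetaMod t 3) = thetaMod t 0 ^ 4 -
      4 * (thetaMod t 0 * thetaMod t 1 * thetaMod t 2 * thetaMod t 3) +
      (thetaMod t 1 ^ 3 * thetaMod t 2 + thetaMod t 2 ^ 3 * thetaMod t 3 +
        thetaMod t 3 ^ 3 * thetaMod t 1) := by
  have hgeom := sum_pow_eq_zero_of_pow_seven hζ hζ1
  have h := thetaTwist_mul_four ht hζ (0, 1, -3, 2) (0, 1, -1, 0) (by norm_num) (by norm_num)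
    (by norm_num) (by norm_num)
  simp only [hB, Fintype.sum_prod_type, Fin.sum_univ_seven] at h
  simp [thetaMod_neg, thetaMod_reduce, zpow_ofNat] at h
  rw [← Complex.ofReal_inj]
  push_cast
  linear_combination h - (thetaMod t 0 * thetaMod t 1 * thetaMod t 2 * thetaMod t 3 : ℂ) * hL
    + (4 * (thetaMod t 0 * thetaMod t 1 * thetaMod t 2 * thetaMod t 3) +
      (thetaMod t 1 ^ 3 * thetaMod t 2 + thetaMod t 2 ^ 3 * thetaMod t 3 +
        thetaMod t 3 ^ 3 * thetaMod t 1) : ℂ) * hgeom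

lemma thetaMod_relation_cubic {t : ℝ} (ht : 0 < t) {ζ : ℂ} (hζ : ζ ^ 7 = 1) {L : ℂ} (hL : L ^ 4 = 7)
    (hB : ∀ j, thetaTwist t ζ j = L * thetaMod t j) (hζ1 : ζ ≠ 1)
    {c₁ c₂ c₃ : ℝ} (h₁ : (c₁ : ℂ) = ζ + ζ ^ 6)
    (h₂ : (c₂ : ℂ) = ζ ^ 2 + ζ ^ 5) (h₃ : (c₃ : ℂ) = ζ ^ 3 + ζ ^ 4) :
    7 * (thetaMod t 1 ^ 3 * thetaMod t 2) = thetaMod t 0 ^ 4 +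
      3 * (thetaMod t 0 * thetaMod t 1 * thetaMod t 2 * thetaMod t 3) +
      (3 * c₁ + c₂) * (thetaMod t 1 ^ 3 * thetaMod t 2) +
      (3 * c₂ + c₃) * (thetaMod t 2 ^ 3 * thetaMod t 3) +
      (3 * c₃ + c₁) * (thetaMod t 3 ^ 3 * thetaMod t 1) := by
  have hgeom := sum_pow_eq_zero_of_pow_seven hζ hζ1
  have h8 : ζ ^ 8 = ζ := by linear_combination ζ * hζ
  have h9 : ζ ^ 9 = ζ ^ 2 := by linear_combination ζ ^ 2 * hζ
  have h10 : ζ ^ 10 = ζ ^ 3 := by linear_combination ζ ^ 3 * hζ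
  have h11 : ζ ^ 11 = ζ ^ 4 := by linear_combination ζ ^ 4 * hζ
  have h12 : ζ ^ 12 = ζ ^ 5 := by linear_combination ζ ^ 5 * hζ
  have h := thetaTwist_mul_four ht hζ (1, 1, 2, -1) (0, 0, 1, 0) (by norm_num) (by norm_num)
    (by norm_num) (by norm_num)
  simp only [hB, Fintype.sum_prod_type, Fin.sum_univ_seven] at h
  simp [thetaMod_neg, thetaMod_reduce, zpow_ofNat, hζ, h8, h9, h10, h11, h12] at h
  rw [← Complex.ofReal_inj]
  push_cast
  rw [h₁, h₂, h₃]
  linear_combination h - (thetaMod t 1 ^ 3 * thetaMod t 2 : ℂ) * hL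
    + 3 * (thetaMod t 0 * thetaMod t 1 * thetaMod t 2 * thetaMod t 3 : ℂ) * hgeom

lemma thetaMod_pos {t : ℝ} (ht : 0 < t) (j : ℤ) : 0 < thetaMod t j :=
  (summable_thetaMod ht j).tsum_pos (fun _ => (Real.exp_pos _).le) 0 (Real.exp_pos _)

lemma thetaMod_three_le {t : ℝ} (ht : 0 < t) (h5 : Real.log 2 ≤ 5 * t) {j : ℤ} (hj0 : 0 ≤ j)
    (hj : j ≤ 2) : thetaMod t 3 ≤ thetaMod t j := by
  have hnat (i : ℤ) : Summable fun n : ℕ => rexp (-t * (7 * ((n : ℤ) : ℝ) + i) ^ 2) :=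
    (summable_thetaMod ht i).comp_injective Nat.cast_injective
  have hneg (i : ℤ) :
      Summable fun n : ℕ => rexp (-t * (7 * ((-((n : ℤ) + 1) : ℤ) : ℝ) + i) ^ 2) :=
    (summable_thetaMod ht i).comp_injective (i := fun n : ℕ => -((n : ℤ) + 1))
      fun a b h => by simpa using h
  have hsplit (i : ℤ) : ∑' n : ℤ, rexp (-t * (7 * (n : ℝ) + i) ^ 2) =
      ∑' n : ℕ, rexp (-t * (7 * ((n : ℤ) : ℝ) + i) ^ 2) +
        ∑' n : ℕ, rexp (-t * (7 * ((-((n : ℤ) + 1) : ℤ) : ℝ) + i) ^ 2) :=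
    tsum_of_nat_of_neg_add_one (f := fun n : ℤ => rexp (-t * (7 * (n : ℝ) + i) ^ 2))
      (hnat i) (hneg i)
  have hj0' : (0 : ℝ) ≤ j := by exact_mod_cast hj0
  have hj' : (j : ℝ) ≤ 2 := by exact_mod_cast hj
  unfold thetaMod
  rw [hsplit 3, hsplit j, ← (hnat 3).tsum_add (hneg 3)]
  refine le_add_of_le_of_nonneg (((hnat 3).add (hneg 3)).tsum_le_tsum (fun n => ?_) (hnat j))
    (tsum_nonneg fun _ => (Real.exp_pos _).le)
  have hn : (0 : ℝ) ≤ n := n.cast_nonneg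
  have h₁ : rexp (-t * (7 * ((-((n : ℤ) + 1) : ℤ) : ℝ) + (3 : ℤ)) ^ 2) ≤
      rexp (-t * (7 * ((n : ℤ) : ℝ) + (3 : ℤ)) ^ 2) := by
    apply Real.exp_le_exp.2
    push_cast
    nlinarith
  have h₂ : 2 * rexp (-t * (7 * ((n : ℤ) : ℝ) + (3 : ℤ)) ^ 2) ≤
      rexp (-t * (7 * ((n : ℤ) : ℝ) + j) ^ 2) := by
    nth_rewrite 1 [← Real.exp_log (show (0 : ℝ) < 2 by norm_num)]
    rw [← Real.exp_add]
    apply Real.exp_le_exp.2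
    push_cast
    have : 5 ≤ (7 * (n : ℝ) + 3) ^ 2 - (7 * (n : ℝ) + j) ^ 2 := by nlinarith
    nlinarith
  linarith

lemma tsum_exp_neg_sq_eq_thetaMod {t : ℝ} (ht : 0 < t) :
    ∑' n : ℤ, rexp (-t * (n : ℝ) ^ 2) =
      thetaMod t 0 + 2 * (thetaMod t 1 + thetaMod t 2 + thetaMod t 3) := by
  have h := (summable_exp_neg_sq ht).hasSum
  rw [← ((Equiv.prodComm _ _).trans (Int.divModEquiv 7).symm).hasSum_iff] at h
  have h' := h.prod_fiberwise (g := fun i : Fin 7 => thetaMod t (i : ℕ)) fun i => by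
    refine (summable_thetaMod ht (i : ℕ)).hasSum.congr_fun fun n => ?_
    simp only [Function.comp, Equiv.trans_apply, Equiv.prodComm_apply, Prod.swap,
      Int.divModEquiv, Equiv.coe_fn_symm_mk]
    push_cast
    ring_nf
  rw [h'.unique (hasSum_fintype _), Fin.sum_univ_seven]
  simp [thetaMod_reduce]
  ring

lemma phi_exp_neg (s : ℝ) : phi (rexp (-s)) = ∑' n : ℤ, rexp (-s * (n : ℝ) ^ 2) := by
  unfold phi
  refine tsum_congr fun n => ?_
  rw [← Real.exp_nat_mul]
  congr 1
  rw [← sq_abs (n : ℝ), ← Int.cast_abs, ← Nat.cast_natAbs]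
  push_cast
  ring

lemma septic_cofactor_pos {c δ : ℝ} (hlo : 1.24 < c) (hhi : c < 1.25) (h₁ : -0.32 < δ)
    (h₂ : δ ≤ 1) : 0 < 6 + c - 2 * c ^ 2 + δ * (4 - c ^ 2) - δ ^ 2 * (3 - c ^ 2) := by
  have h₃ : c ^ 2 ≤ 1.25 ^ 2 := by gcongr
  have h₄ : 1.24 ^ 2 ≤ c ^ 2 := by gcongr
  nlinarith [mul_nonneg (sub_nonneg.2 h₁.le) (sub_nonneg.2 h₃),
    mul_nonneg (sub_nonneg.2 h₁.le) (sub_nonneg.2 h₂),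
    mul_nonneg (mul_nonneg (sub_nonneg.2 h₁.le) (sub_nonneg.2 h₂))
      (show 0 ≤ 3 - c ^ 2 by linarith)]

lemma eq_of_septic_relations {c₁ c₂ c₃ u v w : ℝ} (hc : 1 < c₁) (h₁₂ : c₂ = c₁ ^ 2 - 2)
    (hsum : c₁ + c₂ + c₃ = -1) (h₁₃ : c₁ * c₂ = c₁ + c₃)
    (hu : 0 < u) (hv : 0 < v) (hw : 0 < w) (hwu : w ≤ u) (hwv : w ≤ v)
    (h0 : 7 = 1 + 3 * (u * v * w) + (u ^ 3 * v + v ^ 3 * w + w ^ 3 * u) / 2)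
    (hP : 7 * (u * v * w) / 8 =
      1 - u * v * w / 2 + (u ^ 3 * v + v ^ 3 * w + w ^ 3 * u) / 16)
    (hK : 7 * (u ^ 3 * v) = 16 + 6 * (u * v * w) + (3 * c₁ + c₂) * (u ^ 3 * v) +
      (3 * c₂ + c₃) * (v ^ 3 * w) + (3 * c₃ + c₁) * (w ^ 3 * u)) :
    u ^ 7 * (2 + c₃) ^ 2 = 2 + c₂ ∧ v ^ 7 * (2 + c₂) ^ 2 = 2 + c₁ ∧
      w ^ 7 * (2 + c₁) ^ 2 = 2 + c₃ := by
  have hp : u * v * w = 1 := by linarith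
  have hw1 : w ≤ 1 := by
    by_contra! h
    nlinarith [mul_le_mul hwu hwv hw.le hu.le, mul_pos hw hw]
  have hγ1 : w ^ 3 * u ≤ 1 := by
    have : w ^ 3 * u * v = w ^ 2 := by linear_combination w ^ 2 * hp
    by_contra! h
    nlinarith
  have hγ0 : 0 < w ^ 3 * u := by positivity
  have hprod : (u ^ 3 * v) * (v ^ 3 * w) * (w ^ 3 * u) = 1 := by
    linear_combination ((u * v * w) ^ 3 + (u * v * w) ^ 2 + u * v * w + 1) * hp
  obtain ⟨α, hα⟩ : ∃ α, u ^ 3 * v = α := ⟨_, rfl⟩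
  obtain ⟨β, hβ⟩ : ∃ β, v ^ 3 * w = β := ⟨_, rfl⟩
  obtain ⟨γ, hγ⟩ : ∃ γ, w ^ 3 * u = γ := ⟨_, rfl⟩
  have hu7 : u ^ 7 * β = α ^ 2 := by
    rw [← hα, ← hβ]; linear_combination u ^ 6 * v ^ 2 * hp
  have hv7 : v ^ 7 * γ = β ^ 2 := by
    rw [← hβ, ← hγ]; linear_combination v ^ 6 * w ^ 2 * hp
  have hw7 : w ^ 7 * α = γ ^ 2 := by
    rw [← hα, ← hγ]; linear_combination w ^ 6 * u ^ 2 * hp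
  rw [hα, hβ, hγ, hp] at hK h0
  rw [hα, hβ, hγ] at hprod
  rw [hγ] at hγ0 hγ1
  clear hα hβ hγ hP
  have hc₃ : c₃ = 1 - c₁ - c₁ ^ 2 := by linarith
  subst h₁₂ hc₃
  have hcubic : c₁ ^ 3 + c₁ ^ 2 - 2 * c₁ - 1 = 0 := by linarith
  have hlo : 1.24 < c₁ := by
    by_contra! h
    nlinarith [mul_nonneg (sub_nonneg.2 h) (sub_nonneg.2 hc.le)]
  have hhi : c₁ < 1.25 := by
    by_contra! h
    nlinarith [mul_nonneg (sub_nonneg.2 h) (sub_nonneg.2 hc.le)]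
  obtain ⟨δ, hδ⟩ : ∃ δ, γ - (c₁ ^ 2 - c₁) = δ := ⟨_, rfl⟩
  have hγ : γ = c₁ ^ 2 - c₁ + δ := by linarith
  have hβ : β = 5 - c₁ - 2 * c₁ ^ 2 + (c₁ + c₁ ^ 2 - 2) * δ := by
    have hne : (c₁ - 2) ^ 2 ≠ 0 := by
      have : c₁ - 2 < 0 := by linarith
      exact pow_ne_zero 2 this.ne
    refine mul_left_cancel₀ hne ?_
    rw [hγ] at hK h0
    linear_combination -hK - 2 * (9 - 3 * c₁ - c₁ ^ 2) * h0
      - (12 - 6 * c₁ + (c₁ - 4) * δ) * hcubic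
  have hα : α = 1 + 2 * c₁ + c₁ ^ 2 - (c₁ + c₁ ^ 2 - 1) * δ := by linarith
  have hδ0 : δ = 0 := by
    have hfac : δ * ((1 + 2 * c₁ + c₁ ^ 2) * (5 - c₁ - 2 * c₁ ^ 2)
        + (1 + 2 * c₁ + c₁ ^ 2) * (c₁ ^ 2 - c₁) * (c₁ + c₁ ^ 2 - 2)
        - (c₁ + c₁ ^ 2 - 1) * (5 - c₁ - 2 * c₁ ^ 2) * (c₁ ^ 2 - c₁)
        + δ * ((1 + 2 * c₁ + c₁ ^ 2) * (c₁ + c₁ ^ 2 - 2) - (c₁ + c₁ ^ 2 - 1) *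
          ((5 - c₁ - 2 * c₁ ^ 2) + (c₁ + c₁ ^ 2 - 2) * (c₁ ^ 2 - c₁)))
        - δ ^ 2 * ((c₁ + c₁ ^ 2 - 1) * (c₁ + c₁ ^ 2 - 2))) = 0 := by
      rw [hα, hβ, hγ] at hprod
      linear_combination hprod - (1 + 3 * c₁ - c₁ ^ 2 - 2 * c₁ ^ 3) * hcubic
    refine (mul_eq_zero.1 hfac).resolve_right (ne_of_gt ?_)
    have hsq₁ : 0 ≤ c₁ * (c₁ - 1) := mul_nonneg (by linarith) (by linarith)
    have hsq₂ : c₁ * (c₁ - 1) ≤ 1.25 * 0.25 := by gcongr; linarith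
    have hpos := septic_cofactor_pos hlo hhi (δ := δ) (by linarith) (by linarith)
    exact hpos.trans_eq (by
      linear_combination -(1 - 7 * c₁ + 3 * c₁ ^ 3 + δ * (1 + 5 * c₁ - c₁ ^ 3)
        - δ ^ 2 * (1 + c₁)) * hcubic)
  subst hδ0
  rw [mul_zero, add_zero] at hβ
  rw [mul_zero, sub_zero] at hα
  rw [add_zero] at hγ
  have iα : α * (3 - c₁ - c₁ ^ 2) = 1 := by rw [hα]; linear_combination (-2 - c₁) * hcubic
  have iβ : β * c₁ ^ 2 = 1 := by rw [hβ]; linear_combination (1 - 2 * c₁) * hcubic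
  have iγ : γ * (2 + c₁) = 1 := by rw [hγ]; linear_combination hcubic
  refine ⟨?_, ?_, ?_⟩
  · linear_combination c₁ ^ 2 * (3 - c₁ - c₁ ^ 2) ^ 2 * hu7
      - u ^ 7 * (3 - c₁ - c₁ ^ 2) ^ 2 * iβ + c₁ ^ 2 * (α * (3 - c₁ - c₁ ^ 2) + 1) * iα
  · linear_combination (2 + c₁) * (c₁ ^ 2) ^ 2 * hv7
      - v ^ 7 * (c₁ ^ 2) ^ 2 * iγ + (2 + c₁) * (β * c₁ ^ 2 + 1) * iβ
  · linear_combination (3 - c₁ - c₁ ^ 2) * (2 + c₁) ^ 2 * hw7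
      - w ^ 7 * (2 + c₁) ^ 2 * iα + (3 - c₁ - c₁ ^ 2) * (γ * (2 + c₁) + 1) * iγ

lemma theta_septic_values {t : ℝ} (ht : t = π / (7 * √7)) :
    2 * thetaMod t 1 = thetaMod t 0 *
        (Real.cos (2 * π / 7) / (2 * Real.cos (3 * π / 7) ^ 2)) ^ ((2 : ℝ) / 7) ∧
      2 * thetaMod t 2 = thetaMod t 0 *
        (Real.cos (π / 7) / (2 * Real.cos (2 * π / 7) ^ 2)) ^ ((2 : ℝ) / 7) ∧
      2 * thetaMod t 3 = thetaMod t 0 *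
        (Real.cos (3 * π / 7) / (2 * Real.cos (π / 7) ^ 2)) ^ ((2 : ℝ) / 7) := by
  have hpi := Real.pi_pos
  have ht0 : 0 < t := by rw [ht]; positivity
  have h5 : Real.log 2 ≤ 5 * t := by
    have h7 : √7 ≤ 2.65 := Real.sqrt_le_iff.2 (by norm_num)
    have h7' : 0 < √7 := by positivity
    rw [ht, ← mul_div_assoc, le_div_iff₀ (by positivity)]
    nlinarith [Real.log_two_lt_d9, Real.log_two_gt_d9, Real.pi_gt_d2]
  obtain ⟨ζ, hζdef⟩ : ∃ ζ, Complex.exp (2 * π * Complex.I / 7) = ζ := ⟨_, rfl⟩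
  have hB (j : ℤ) := thetaTwist_eq ht j
  have hpow (n : ℕ) : ζ ^ n = Complex.exp (((2 * n * π / 7 : ℝ) : ℂ) * Complex.I) := by
    rw [← hζdef, ← Complex.exp_nat_mul]
    congr 1
    push_cast
    ring
  rw [hζdef] at hB
  have hζ : ζ ^ 7 = 1 := by
    rw [hpow, ← Complex.exp_two_pi_mul_I]
    congr 1
    push_cast
    ring
  have hcos (m n : ℕ) (hmn : m + n = 7) :
      ((2 * Real.cos (2 * m * π / 7) : ℝ) : ℂ) = ζ ^ m + ζ ^ n := by
    have hn : (n : ℝ) = 7 - m := by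
      have : (m : ℝ) + n = 7 := by exact_mod_cast hmn
      linarith
    have hinv : ζ ^ n = Complex.exp (-((2 * m * π / 7 : ℝ) : ℂ) * Complex.I) := by
      rw [hpow, ← Complex.exp_periodic.sub_eq, hn]
      congr 1
      push_cast
      ring
    rw [hinv, hpow, Complex.ofReal_mul, Complex.ofReal_cos, Complex.ofReal_ofNat, Complex.two_cos]
  have h₁ := hcos 1 6 rfl
  have h₂ := hcos 2 5 rfl
  have h₃ := hcos 3 4 rfl
  have hcos1 : 1 < 2 * Real.cos (2 * (1 : ℕ) * π / 7) := by
    have := Real.cos_lt_cos_of_nonneg_of_le_pi (x := 2 * (1 : ℕ) * π / 7) (y := π / 3)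
      (by positivity) (by linarith) (by push_cast; linarith)
    rw [Real.cos_pi_div_three] at this
    linarith
  have hζ1 : ζ ≠ 1 := by
    rintro rfl
    have : 2 * Real.cos (2 * (2 : ℕ) * π / 7) = 1 + 1 := by
      rw [← Complex.ofReal_inj, h₂]; norm_num
    have := Real.cos_lt_cos_of_nonneg_of_le_pi (x := 0) (y := 2 * (2 : ℕ) * π / 7)
      le_rfl (by push_cast; linarith) (by positivity)
    rw [Real.cos_zero] at this
    linarith
  have hgeom := sum_pow_eq_zero_of_pow_seven hζ hζ1
  have e₁ : 2 + 2 * Real.cos (2 * (1 : ℕ) * π / 7) = 4 * Real.cos (π / 7) ^ 2 := by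
    rw [Real.cos_sq]; push_cast; ring_nf
  have e₂ : 2 + 2 * Real.cos (2 * (2 : ℕ) * π / 7) = 4 * Real.cos (2 * π / 7) ^ 2 := by
    rw [Real.cos_sq]; push_cast; ring_nf
  have e₃ : 2 + 2 * Real.cos (2 * (3 : ℕ) * π / 7) = 4 * Real.cos (3 * π / 7) ^ 2 := by
    rw [Real.cos_sq]; push_cast; ring_nf
  generalize 2 * Real.cos (2 * (1 : ℕ) * π / 7) = c₁ at h₁ hcos1 e₁
  generalize 2 * Real.cos (2 * (2 : ℕ) * π / 7) = c₂ at h₂ e₂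
  generalize 2 * Real.cos (2 * (3 : ℕ) * π / 7) = c₃ at h₃ e₃
  rw [pow_one] at h₁
  have r0 := thetaMod_relation_zero ht0 hζ thetaFactor_pow_four hB
  have rP := thetaMod_relation_mixed ht0 hζ thetaFactor_pow_four hB hζ1
  have rK := thetaMod_relation_cubic ht0 hζ thetaFactor_pow_four hB hζ1 h₁ h₂ h₃
  have l₁ : thetaMod t 3 ≤ thetaMod t 1 := thetaMod_three_le ht0 h5 (by norm_num) (by norm_num)
  have l₂ : thetaMod t 3 ≤ thetaMod t 2 := thetaMod_three_le ht0 h5 (by norm_num) (by norm_num)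
  have p0 := thetaMod_pos ht0 0
  have p1 := thetaMod_pos ht0 1
  have p2 := thetaMod_pos ht0 2
  have p3 := thetaMod_pos ht0 3
  generalize thetaMod t 0 = a at *
  generalize thetaMod t 1 = x at *
  generalize thetaMod t 2 = y at *
  generalize thetaMod t 3 = z at *
  have hx : 2 * x = a * (2 * x / a) := by field_simp
  have hy : 2 * y = a * (2 * y / a) := by field_simp
  have hz : 2 * z = a * (2 * z / a) := by field_simp
  obtain ⟨hu, hv, hw⟩ := eq_of_septic_relations (c₁ := c₁) (c₂ := c₂) (c₃ := c₃)
    (u := 2 * x / a) (v := 2 * y / a) (w := 2 * z / a) hcos1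
    (by
      rw [← Complex.ofReal_inj]; push_cast; rw [h₁, h₂]
      linear_combination (-2 - ζ ^ 5) * hζ)
    (by
      rw [← Complex.ofReal_inj]; push_cast; rw [h₁, h₂, h₃]
      linear_combination hgeom)
    (by
      rw [← Complex.ofReal_inj]; push_cast; rw [h₁, h₂, h₃]
      linear_combination (ζ + ζ ^ 4) * hζ)
    (by positivity) (by positivity) (by positivity) (by gcongr) (by gcongr)
    (by field_simp; linear_combination r0)
    (by field_simp; linear_combination 128 * rP)
    (by field_simp; linear_combination 16 * rK)
  have root {s k l : ℝ} (hs : 0 < s) (hk : 0 < k) (hl : 0 < l)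
      (h : s ^ 7 * (4 * l ^ 2) ^ 2 = 4 * k ^ 2) : s = (k / (2 * l ^ 2)) ^ ((2 : ℝ) / 7) := by
    have hsq : (k / (2 * l ^ 2)) ^ (2 : ℝ) = s ^ 7 := by
      rw [Real.rpow_two]
      field_simp
      linarith
    rw [div_eq_mul_inv (2 : ℝ), Real.rpow_mul (by positivity), hsq]
    exact (Real.pow_rpow_inv_natCast hs.le (by norm_num)).symm
  have k₁ : 0 < Real.cos (π / 7) := Real.cos_pos_of_mem_Ioo ⟨by linarith, by linarith⟩
  have k₂ : 0 < Real.cos (2 * π / 7) := Real.cos_pos_of_mem_Ioo ⟨by linarith, by linarith⟩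
  have k₃ : 0 < Real.cos (3 * π / 7) := Real.cos_pos_of_mem_Ioo ⟨by linarith, by linarith⟩
  rw [e₃, e₂] at hu
  rw [e₂, e₁] at hv
  rw [e₁, e₃] at hw
  rw [hx, hy, hz, root (by positivity) k₂ k₃ hu, root (by positivity) k₁ k₂ hv,
    root (by positivity) k₃ k₁ hw]
  exact ⟨rfl, rfl, rfl⟩

theorem phi_exp_neg_seven_pi_sqrt_seven :
    phi (Real.exp (-7 * π * Real.sqrt 7)) =
      (7 : ℝ) ^ (-(3:ℝ)/4) * phi (Real.exp (-π * Real.sqrt 7)) *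
        (1 + (Real.cos (π/7) / (2 * Real.cos (2*π/7) ^ 2)) ^ ((2:ℝ)/7)
           + (Real.cos (2*π/7) / (2 * Real.cos (3*π/7) ^ 2)) ^ ((2:ℝ)/7)
           + (Real.cos (3*π/7) / (2 * Real.cos (π/7) ^ 2)) ^ ((2:ℝ)/7)) := by
  obtain ⟨t, ht⟩ : ∃ t, t = π / (7 * √7) := ⟨_, rfl⟩
  have hpi := Real.pi_pos
  have ht0 : 0 < t := by rw [ht]; positivity
  have hsq : √7 * √7 = 7 := Real.mul_self_sqrt (by norm_num)
  obtain ⟨hx, hy, hz⟩ := theta_septic_values ht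
  have h0 : phi (rexp (-π * √7)) = thetaMod t 0 := by
    rw [neg_mul, phi_exp_neg]
    refine tsum_congr fun n => ?_
    congr 1
    rw [ht]
    push_cast
    field_simp
    linear_combination -(7 * (n : ℝ) ^ 2) * hsq
  have h1 : phi (rexp (-7 * π * √7)) = (7 : ℝ) ^ (-(3 : ℝ) / 4) *
      ∑' n : ℤ, rexp (-t * (n : ℝ) ^ 2) := by
    have h := Real.tsum_exp_neg_mul_int_sq (a := 7 * √7) (by positivity)
    rw [show -7 * π * √7 = -(π * (7 * √7)) by ring, phi_exp_neg, ht]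
    convert h using 1
    · refine tsum_congr fun n => ?_
      ring_nf
    · congr 1
      · have : 7 * √7 = (7 : ℝ) ^ ((3 : ℝ) / 2) := by
          rw [Real.sqrt_eq_rpow, ← Real.rpow_one_add' (by norm_num) (by norm_num)]
          norm_num
        rw [this, ← Real.rpow_mul (by norm_num), one_div, ← Real.rpow_neg (by norm_num)]
        norm_num
      · refine tsum_congr fun n => ?_
        ring_nf
  rw [h1, tsum_exp_neg_sq_eq_thetaMod ht0, h0]
  linear_combination (7 : ℝ) ^ (-(3 : ℝ) / 4) * (hx + hy + hz)
end

section
/- For 0 < x < 1, define z(x) = ₂F₁(1/2, 1/2; 1; x). Then with q(x) = exp(−π · ₂F₁(1/2,1/2;1;1−x)/₂F₁(1/2,1/2;1;x)), one has z(x) = φ²(q(x)), where φ(q) = ∑_{n ∈ ℤ} q^{n²}. -/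
open Real

/-- The Gauss hypergeometric series `₂F₁(a, b; c; x)` over ℝ. -/
noncomputable def hyp2F1 (a b c x : ℝ) : ℝ :=
  ∑' n : ℕ, ((ascPochhammer ℝ n).eval a * (ascPochhammer ℝ n).eval b /
    ((ascPochhammer ℝ n).eval c * n.factorial)) * x ^ n

/-- A power series with coefficients bounded by one converges on `(-1, 1)`. -/
theorem summable_mul_pow_of_abs_le_one {a : ℕ → ℝ} (ha : ∀ n, |a n| ≤ 1) {x : ℝ} (hx : |x| < 1) :
    Summable fun n => a n * x ^ n := by
  refine .of_norm_bounded (summable_geometric_of_lt_one (abs_nonneg x) hx) fun n => ?_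
  rw [norm_mul, norm_pow, Real.norm_eq_abs, Real.norm_eq_abs]
  exact mul_le_of_le_one_left (by positivity) (ha n)

/-- The termwise derivative of a power series with coefficients bounded by one converges. -/
theorem summable_succ_mul_pow_of_abs_le_one {a : ℕ → ℝ} (ha : ∀ n, |a n| ≤ 1) {x : ℝ}
    (hx : |x| < 1) : Summable fun n : ℕ => (n + 1 : ℝ) * a (n + 1) * x ^ n := by
  have h := (summable_pow_mul_geometric_of_norm_lt_one 1 (r := |x|) (by simpa using hx)).add
    (summable_geometric_of_lt_one (abs_nonneg x) hx)
  refine .of_norm_bounded h fun n => ?_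
  rw [norm_mul, norm_mul, norm_pow, Real.norm_eq_abs, Real.norm_eq_abs, Real.norm_eq_abs,
    abs_of_nonneg (by positivity : (0 : ℝ) ≤ n + 1)]
  have : (n + 1 : ℝ) * |a (n + 1)| ≤ (n + 1) := mul_le_of_le_one_right (by positivity) (ha _)
  nlinarith [pow_nonneg (abs_nonneg x) n]

/-- Termwise differentiation of a power series with coefficients bounded by one. -/
theorem hasDerivAt_tsum_mul_pow {a : ℕ → ℝ} (ha : ∀ n, |a n| ≤ 1) {x : ℝ} (hx : |x| < 1) :
    HasDerivAt (fun y => ∑' n, a n * y ^ n) (∑' n : ℕ, (n + 1 : ℝ) * a (n + 1) * x ^ n) x := by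
  obtain ⟨r, hxr, hr⟩ := exists_between hx
  have hr0 : 0 ≤ r := (abs_nonneg x).trans hxr.le
  have hu : Summable fun n : ℕ => (n : ℝ) * r ^ (n - 1) := by
    rw [← summable_nat_add_iff 1]
    have h := summable_succ_mul_pow_of_abs_le_one (a := fun _ => 1) (by simp) (x := r)
      (by rwa [abs_of_nonneg hr0])
    simpa using h
  have h := hasDerivAt_tsum_of_isPreconnected (g := fun n y => a n * y ^ n)
    (g' := fun n y => a n * (n * y ^ (n - 1))) (t := Set.Ioo (-r) r) (y₀ := x) (y := x) hu isOpen_Ioo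
    isPreconnected_Ioo (fun n y _ => (hasDerivAt_pow n y).const_mul _) ?_ (abs_lt.1 hxr)
    (summable_mul_pow_of_abs_le_one ha hx) (abs_lt.1 hxr)
  · refine h.congr_deriv ?_
    have hs : Summable fun n : ℕ => a n * (n * x ^ (n - 1)) := by
      rw [← summable_nat_add_iff 1]
      refine (summable_succ_mul_pow_of_abs_le_one ha hx).congr fun n => ?_
      push_cast [Nat.add_sub_cancel]
      ring
    rw [hs.tsum_eq_zero_add]
    simp only [CharP.cast_eq_zero, zero_mul, mul_zero, zero_add]
    refine tsum_congr fun n => ?_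
    push_cast [Nat.add_sub_cancel]
    ring
  · intro n y hy
    rw [norm_mul, norm_mul, norm_pow, Real.norm_eq_abs, Real.norm_eq_abs, Real.norm_eq_abs,
      abs_of_nonneg (by positivity : (0 : ℝ) ≤ n)]
    refine (mul_le_of_le_one_left (by positivity) (ha n)).trans ?_
    gcongr
    exact (abs_lt.2 hy).le

/-- The coefficients of `₂F₁(1/2, 1/2; 1; x)`. -/
noncomputable def ellipticCoeff (n : ℕ) : ℝ :=
  (ascPochhammer ℝ n).eval (1/2) * (ascPochhammer ℝ n).eval (1/2) /
    ((ascPochhammer ℝ n).eval 1 * n.factorial)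

theorem ellipticCoeff_zero : ellipticCoeff 0 = 1 := by simp [ellipticCoeff]

theorem ellipticCoeff_nonneg (n : ℕ) : 0 ≤ ellipticCoeff n := by
  have := ascPochhammer_pos n (1 : ℝ) one_pos
  unfold ellipticCoeff
  have := mul_self_nonneg ((ascPochhammer ℝ n).eval (1/2 : ℝ))
  positivity

theorem ellipticCoeff_succ (n : ℕ) :
    ellipticCoeff (n + 1) * (n + 1) ^ 2 = ellipticCoeff n * (n + 1/2) ^ 2 := by
  have := ascPochhammer_pos n (1 : ℝ) one_pos
  unfold ellipticCoeff
  simp only [ascPochhammer_succ_eval, Nat.factorial_succ]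
  push_cast
  field_simp
  ring

theorem abs_ellipticCoeff_le_one (n : ℕ) : |ellipticCoeff n| ≤ 1 := by
  rw [abs_of_nonneg (ellipticCoeff_nonneg n)]
  induction n with
  | zero => rw [ellipticCoeff_zero]
  | succ n ih =>
    have h := ellipticCoeff_succ n
    have h0 := ellipticCoeff_nonneg n
    by_contra! hc
    nlinarith [sq_nonneg (n + 1 : ℝ), sq_nonneg (n + 1/2 : ℝ), (n.cast_nonneg : (0 : ℝ) ≤ n)]

/-- The function `z(x) = ₂F₁(1/2, 1/2; 1; x)`. -/
noncomputable def ellipticZ (x : ℝ) : ℝ := ∑' n, ellipticCoeff n * x ^ n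

/-- The derivative of `ellipticZ`. -/
noncomputable def ellipticZDeriv (x : ℝ) : ℝ :=
  ∑' n : ℕ, (n + 1 : ℝ) * ellipticCoeff (n + 1) * x ^ n

theorem hyp2F1_half_half_one (x : ℝ) : hyp2F1 (1/2) (1/2) 1 x = ellipticZ x := rfl

theorem ellipticZ_zero : ellipticZ 0 = 1 := by
  unfold ellipticZ
  rw [tsum_eq_single 0 fun n hn => by simp [hn]]
  simp [ellipticCoeff_zero]

theorem ellipticZDeriv_zero : ellipticZDeriv 0 = 1/4 := by
  unfold ellipticZDeriv
  rw [tsum_eq_single 0 fun n hn => by simp [hn]]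
  have := ellipticCoeff_succ 0
  rw [ellipticCoeff_zero] at this
  norm_num at this ⊢
  exact this

theorem hasDerivAt_ellipticZ {x : ℝ} (hx : |x| < 1) :
    HasDerivAt ellipticZ (ellipticZDeriv x) x :=
  hasDerivAt_tsum_mul_pow abs_ellipticCoeff_le_one hx

theorem ellipticZ_pos {x : ℝ} (hx0 : 0 ≤ x) (hx1 : x < 1) : 0 < ellipticZ x := by
  have h := summable_mul_pow_of_abs_le_one abs_ellipticCoeff_le_one
    (by rwa [abs_of_nonneg hx0] : |x| < 1)
  exact h.tsum_pos (fun n => mul_nonneg (ellipticCoeff_nonneg n) (by positivity)) 0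
    (by simp [ellipticCoeff_zero])

/-- The hypergeometric equation in the form `(x (1 - x) z')' = z / 4`. -/
theorem hasDerivAt_mul_ellipticZDeriv {x : ℝ} (hx : |x| < 1) :
    HasDerivAt (fun y => y * (1 - y) * ellipticZDeriv y) (ellipticZ x / 4) x := by
  let e : ℕ → ℝ := fun n => n.casesOn 0 fun m => ellipticCoeff m / (4 * (m + 1))
  have he : ∀ n, |e n| ≤ 1 := by
    rintro (_ | n)
    · simp [e]
    · change |ellipticCoeff n / (4 * (n + 1))| ≤ 1
      rw [abs_div, abs_of_pos (by positivity : (0 : ℝ) < 4 * (n + 1))]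
      refine div_le_one_of_le₀ ((abs_ellipticCoeff_le_one n).trans ?_) (by positivity)
      linarith [(n.cast_nonneg : (0 : ℝ) ≤ n)]
  have h := hasDerivAt_tsum_mul_pow he hx
  have h1 : ∑' n : ℕ, (n + 1 : ℝ) * e (n + 1) * x ^ n = ellipticZ x / 4 := by
    rw [ellipticZ, ← tsum_div_const]
    refine tsum_congr fun n => ?_
    change (n + 1 : ℝ) * (ellipticCoeff n / (4 * (n + 1))) * x ^ n = _
    field_simp
  rw [h1] at h
  refine h.congr_of_eventuallyEq ?_
  filter_upwards [continuous_abs.continuousAt.eventually_lt_const hx] with y hy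
  have hs := (summable_succ_mul_pow_of_abs_le_one abs_ellipticCoeff_le_one hy).hasSum
  have hs2 : HasSum (fun n : ℕ => (n : ℝ) * ellipticCoeff n * y ^ n) (y * ellipticZDeriv y) := by
    rw [← hasSum_nat_add_iff' 1]
    simp only [Finset.sum_range_one, CharP.cast_eq_zero, zero_mul, sub_zero]
    refine (hs.mul_left y).congr_fun fun n => ?_
    push_cast
    ring
  rw [(summable_mul_pow_of_abs_le_one he hy).tsum_eq_zero_add]
  change _ = 0 * y ^ 0 + ∑' n : ℕ, ellipticCoeff n / (4 * (n + 1)) * y ^ (n + 1)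
  have h3 : HasSum (fun n : ℕ => ellipticCoeff n / (4 * (n + 1)) * y ^ (n + 1))
      (y * (ellipticZDeriv y - y * ellipticZDeriv y)) := by
    refine ((hs.sub hs2).mul_left y).congr_fun fun n => ?_
    have := ellipticCoeff_succ n
    have h4 : ellipticCoeff (n + 1) = ellipticCoeff n * (n + 1/2) ^ 2 / (n + 1) ^ 2 := by
      field_simp; linarith
    rw [h4]
    field_simp
    ring
  rw [h3.tsum_eq]
  ring

/-- Landen's transformation of `₂F₁(1/2, 1/2; 1; x)`. -/
theorem ellipticZ_landen {t : ℝ} (ht0 : 0 ≤ t) (ht1 : t < 1) :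
    ellipticZ (4 * t / (1 + t) ^ 2) = (1 + t) * ellipticZ (t ^ 2) := by
  set X : ℝ → ℝ := fun s => 4 * s / (1 + s) ^ 2 with hX
  have hXd : ∀ s, 0 ≤ s → HasDerivAt X (4 * (1 - s) / (1 + s) ^ 3) s := fun s hs => by
    have h := ((hasDerivAt_id s).const_mul 4).div (((hasDerivAt_id s).const_add 1).pow 2)
      (by simp only [id, Pi.pow_apply]; positivity)
    refine h.congr_deriv ?_
    simp only [id, Pi.pow_apply]
    field_simp
    ring
  have hXlt : ∀ s, 0 ≤ s → s < 1 → |X s| < 1 := fun s hs hs1 => by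
    rw [abs_of_nonneg (by positivity), div_lt_one (by positivity)]
    nlinarith [sq_pos_of_pos (sub_pos.2 hs1)]
  have hsq : ∀ s : ℝ, 0 ≤ s → s < 1 → |s ^ 2| < 1 := fun s hs hs1 => by
    rw [abs_of_nonneg (by positivity)]
    nlinarith
  set u : ℝ → ℝ := fun s => ellipticZ (X s) with hu
  set v : ℝ → ℝ := fun s => (1 + s) * ellipticZ (s ^ 2) with hv
  set u' : ℝ → ℝ := fun s => ellipticZDeriv (X s) * (4 * (1 - s) / (1 + s) ^ 3) with hu'
  set v' : ℝ → ℝ := fun s => ellipticZ (s ^ 2) + (1 + s) * (ellipticZDeriv (s ^ 2) * (2 * s))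
    with hv'
  set U : ℝ → ℝ := fun s => X s * (1 - X s) * ellipticZDeriv (X s) with hU
  set V : ℝ → ℝ := fun s => (s * (1 - s) * ellipticZ (s ^ 2)
    + 2 * (s ^ 2 * (1 - s ^ 2) * ellipticZDeriv (s ^ 2))) / (1 + s) with hV
  have hud : ∀ s, 0 ≤ s → s < 1 → HasDerivAt u (u' s) s := fun s hs hs1 =>
    (hasDerivAt_ellipticZ (hXlt s hs hs1)).comp s (hXd s hs)
  have hsd : ∀ s : ℝ, HasDerivAt (fun s : ℝ => s ^ 2) (2 * s) s := fun s => by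
    simpa using hasDerivAt_pow 2 s
  have hzd : ∀ s : ℝ, 0 ≤ s → s < 1 → HasDerivAt (fun s : ℝ => ellipticZ (s ^ 2))
      (ellipticZDeriv (s ^ 2) * (2 * s)) s := fun s hs hs1 =>
    HasDerivAt.comp (h₂ := ellipticZ) (h := fun r => r ^ 2) s
      (hasDerivAt_ellipticZ (hsq s hs hs1)) (hsd s)
  have hvd : ∀ s, 0 ≤ s → s < 1 → HasDerivAt v (v' s) s := fun s hs hs1 => by
    refine (((hasDerivAt_id s).const_add 1).mul (hzd s hs hs1)).congr_deriv ?_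
    simp [hv']
  have hUd : ∀ s, 0 ≤ s → s < 1 → HasDerivAt U (u s * ((1 - s) / (1 + s) ^ 3)) s :=
    fun s hs hs1 => by
    refine ((hasDerivAt_mul_ellipticZDeriv (hXlt s hs hs1)).comp s (hXd s hs)).congr_deriv ?_
    simp only [hu]
    ring
  have hVd : ∀ s, 0 ≤ s → s < 1 → HasDerivAt V (v s * ((1 - s) / (1 + s) ^ 3)) s :=
    fun s hs hs1 => by
    have h2 := HasDerivAt.comp (h₂ := fun y => y * (1 - y) * ellipticZDeriv y)
      (h := fun r => r ^ 2) s (hasDerivAt_mul_ellipticZDeriv (hsq s hs hs1)) (hsd s)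
    have h1 := ((hasDerivAt_id s).mul ((hasDerivAt_id s).const_sub 1)).mul (hzd s hs hs1)
    have h := (h1.add (h2.const_mul 2)).div ((hasDerivAt_id s).const_add 1)
      (by simp only [id]; positivity)
    refine h.congr_deriv ?_
    simp only [id, hv, Function.comp, Pi.mul_apply, Pi.add_apply]
    field_simp
    ring
  have hUu : ∀ s, 0 ≤ s → U s * (1 + s) = s * (1 - s) * u' s := fun s hs => by
    simp only [hU, hu', hX]
    field_simp
    ring
  have hVv : ∀ s, 0 ≤ s → V s * (1 + s) = s * (1 - s) * v' s := fun s hs => by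
    simp only [hV, hv']
    field_simp
    ring
  have hcomm : ∀ s, 0 ≤ s → U s * v' s = u' s * V s := fun s hs => by
    have : (1 + s) * (U s * v' s) = (1 + s) * (u' s * V s) := by
      linear_combination v' s * hUu s hs - u' s * hVv s hs
    exact mul_left_cancel₀ (by positivity) this
  have hW : ∀ s, 0 ≤ s → s < 1 → U s * v s = u s * V s := fun s hs hs1 => by
    have hd : ∀ r, 0 ≤ r → r < 1 → HasDerivAt (fun r => U r * v r - u r * V r) 0 r :=
      fun r hr hr1 => by
      refine (((hUd r hr hr1).mul (hvd r hr hr1)).sub ((hud r hr hr1).mul (hVd r hr hr1))).congr_deriv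
        ?_
      linear_combination hcomm r hr
    have h := constant_of_has_deriv_right_zero (a := 0) (b := s)
      (fun r hr => (hd r hr.1 (hr.2.trans_lt hs1)).continuousAt.continuousWithinAt)
      (fun r hr => (hd r hr.1 (hr.2.trans hs1)).hasDerivWithinAt) s ⟨hs, le_rfl⟩
    have h0 : U 0 * v 0 - u 0 * V 0 = 0 := by simp [hU, hV, hX]
    linarith
  have hvpos : ∀ s, 0 ≤ s → s < 1 → 0 < v s := fun s hs hs1 =>
    mul_pos (by positivity) (ellipticZ_pos (by positivity) (lt_of_abs_lt (hsq s hs hs1)))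
  have hder : ∀ s, 0 ≤ s → s < 1 → u' s * v s = u s * v' s := fun s hs hs1 => by
    rcases hs.eq_or_lt with rfl | hs
    · simp [hu, hv, hu', hv', hX, ellipticZ_zero, ellipticZDeriv_zero]
    · have : s * (1 - s) * (u' s * v s) = s * (1 - s) * (u s * v' s) := by
        linear_combination (1 + s) * hW s hs.le hs1 - v s * hUu s hs.le + u s * hVv s hs.le
      exact mul_left_cancel₀ (mul_pos hs (sub_pos.2 hs1)).ne' this
  have hd : ∀ r, 0 ≤ r → r < 1 → HasDerivAt (fun r => u r / v r) 0 r := fun r hr hr1 => by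
    refine ((hud r hr hr1).div (hvd r hr hr1) (hvpos r hr hr1).ne').congr_deriv ?_
    rw [hder r hr hr1, sub_self, zero_div]
  have h := constant_of_has_deriv_right_zero (a := 0) (b := t)
    (fun r hr => (hd r hr.1 (hr.2.trans_lt ht1)).continuousAt.continuousWithinAt)
    (fun r hr => (hd r hr.1 (hr.2.trans ht1)).hasDerivWithinAt) t ⟨ht0, le_rfl⟩
  have h0 : u 0 / v 0 = 1 := by simp [hu, hv, hX, ellipticZ_zero]
  rw [h0, div_eq_one_iff_eq (hvpos t ht0 ht1).ne'] at h
  exact h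

/-- The theta series `∑_{n ∈ ℤ} q^{n (n + 1)}`. -/
noncomputable def oblongTheta (q : ℝ) : ℝ := ∑' n : ℤ, q ^ (n * (n + 1))

theorem phi_eq_tsum_zpow (q : ℝ) : phi q = ∑' n : ℤ, q ^ (n ^ 2) := by
  refine tsum_congr fun n => ?_
  rw [← zpow_natCast]
  simp

theorem summable_pow_natAbs {r : ℝ} (hr0 : 0 ≤ r) (hr : r < 1) :
    Summable fun n : ℤ => r ^ n.natAbs := by
  have h := summable_geometric_of_lt_one hr0 hr
  exact Summable.of_nat_of_neg (by simpa using h) (by simpa using h)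

theorem summable_zpow_of_abs_sub_one_le {q : ℝ} (hq0 : q ≠ 0) (hq : |q| < 1) {e : ℤ → ℤ}
    (he : ∀ n, |n| - 1 ≤ e n) : Summable fun n : ℤ => q ^ e n := by
  refine .of_norm_bounded ((summable_pow_natAbs (abs_nonneg q) hq).mul_right |q|⁻¹) fun n => ?_
  have h0 : 0 < |q| := abs_pos.2 hq0
  rw [norm_zpow, Real.norm_eq_abs, ← zpow_natCast, ← zpow_sub_one₀ h0.ne', Int.natCast_natAbs]
  exact zpow_le_zpow_right_of_le_one₀ h0 hq.le (he n)

theorem summable_zpow_sq {q : ℝ} (hq0 : q ≠ 0) (hq : |q| < 1) :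
    Summable fun n : ℤ => q ^ (n ^ 2) :=
  summable_zpow_of_abs_sub_one_le hq0 hq fun n => by
    rcases abs_cases n with ⟨h, _⟩ | ⟨h, _⟩ <;> rw [h] <;> nlinarith

theorem summable_zpow_mul_add_one {q : ℝ} (hq0 : q ≠ 0) (hq : |q| < 1) :
    Summable fun n : ℤ => q ^ (n * (n + 1)) :=
  summable_zpow_of_abs_sub_one_le hq0 hq fun n => by
    rcases abs_cases n with ⟨h, _⟩ | ⟨h, _⟩ <;> rw [h] <;> nlinarith

/-- Splitting a sum over `ℤ × ℤ` according to the parity of the sum of the coordinates. -/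
theorem tsum_int_prod_eq_add {f : ℤ × ℤ → ℝ} (hf : Summable f) :
    ∑' z, f z = ∑' z : ℤ × ℤ, f (z.1 + z.2, z.1 - z.2)
      + ∑' z : ℤ × ℤ, f (z.1 + z.2 + 1, z.1 - z.2) := by
  let i : ℤ × ℤ → ℤ × ℤ := fun z => (z.1 + z.2, z.1 - z.2)
  let j : ℤ × ℤ → ℤ × ℤ := fun z => (z.1 + z.2 + 1, z.1 - z.2)
  have hi : Function.Injective i := fun z w h => by
    have h1 := congrArg Prod.fst h
    have h2 := congrArg Prod.snd h
    simp only [i] at h1 h2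
    ext <;> omega
  have hj : Function.Injective j := fun z w h => by
    have h1 := congrArg Prod.fst h
    have h2 := congrArg Prod.snd h
    simp only [j] at h1 h2
    ext <;> omega
  have hc : IsCompl (Set.range i) (Set.range j) := by
    refine IsCompl.of_eq (Set.eq_empty_of_forall_notMem ?_) (Set.eq_univ_of_forall ?_)
    · rintro _ ⟨⟨z, rfl⟩, w, h⟩
      have h1 := congrArg Prod.fst h
      have h2 := congrArg Prod.snd h
      simp only [i, j] at h1 h2
      omega
    · rintro ⟨m, n⟩
      rcases Int.even_or_odd' (m + n) with ⟨k, h | h⟩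
      · exact Or.inl ⟨(k, k - n), by simp only [i, Prod.mk.injEq]; omega⟩
      · exact Or.inr ⟨(k, k - n), by simp only [j, Prod.mk.injEq]; omega⟩
  exact ((hi.hasSum_range_iff.2 (hf.comp_injective hi).hasSum).add_isCompl hc
    (hj.hasSum_range_iff.2 (hf.comp_injective hj).hasSum)).tsum_eq

theorem tsum_mul_tsum_eq_tsum_prod {f g : ℤ → ℝ} (hf : Summable f) (hg : Summable g) :
    (∑' n, f n) * ∑' n, g n = ∑' z : ℤ × ℤ, f z.1 * g z.2 :=
  tsum_mul_tsum_of_summable_norm hf.norm hg.norm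

theorem tsum_mul_tsum_eq_add {f g : ℤ → ℝ} (hf : Summable f) (hg : Summable g) :
    (∑' n, f n) * ∑' n, g n = ∑' z : ℤ × ℤ, f (z.1 + z.2) * g (z.1 - z.2)
      + ∑' z : ℤ × ℤ, f (z.1 + z.2 + 1) * g (z.1 - z.2) := by
  rw [tsum_mul_tsum_eq_tsum_prod hf hg,
    tsum_int_prod_eq_add (summable_mul_of_summable_norm hf.norm hg.norm)]

section

variable {q : ℝ}

theorem abs_sq_lt_one (hq : |q| < 1) : |q ^ 2| < 1 := by
  rw [abs_pow]
  exact pow_lt_one₀ (abs_nonneg q) hq two_ne_zero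

theorem phi_sq_eq_add (hq0 : q ≠ 0) (hq : |q| < 1) :
    phi q ^ 2 = phi (q ^ 2) ^ 2 + q * oblongTheta (q ^ 2) ^ 2 := by
  have hs := summable_zpow_sq hq0 hq
  have hs2 := summable_zpow_sq (pow_ne_zero 2 hq0) (abs_sq_lt_one hq)
  have ho2 := summable_zpow_mul_add_one (pow_ne_zero 2 hq0) (abs_sq_lt_one hq)
  simp only [phi_eq_tsum_zpow, oblongTheta, sq (∑' _, _)]
  rw [tsum_mul_tsum_eq_add hs hs, tsum_mul_tsum_eq_tsum_prod hs2 hs2,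
    tsum_mul_tsum_eq_tsum_prod ho2 ho2, ← tsum_mul_left]
  congr 1 <;> refine tsum_congr fun z => ?_
  · simp only [← zpow_natCast q 2, ← zpow_mul, ← zpow_add₀ hq0]
    congr 1
    push_cast
    ring
  · simp only [← zpow_natCast q 2, ← zpow_mul, ← zpow_add₀ hq0, ← zpow_one_add₀ hq0]
    congr 1
    push_cast
    ring

theorem oblongTheta_sq (hq0 : q ≠ 0) (hq : |q| < 1) :
    oblongTheta q ^ 2 = 2 * (phi (q ^ 2) * oblongTheta (q ^ 2)) := by
  have ho := summable_zpow_mul_add_one hq0 hq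
  have hs2 := summable_zpow_sq (pow_ne_zero 2 hq0) (abs_sq_lt_one hq)
  have ho2 := summable_zpow_mul_add_one (pow_ne_zero 2 hq0) (abs_sq_lt_one hq)
  simp only [phi_eq_tsum_zpow, oblongTheta, sq (∑' _, _)]
  rw [tsum_mul_tsum_eq_add ho ho, two_mul]
  congr 1
  · rw [mul_comm, tsum_mul_tsum_eq_tsum_prod ho2 hs2]
    refine tsum_congr fun z => ?_
    simp only [← zpow_natCast q 2, ← zpow_mul, ← zpow_add₀ hq0]
    congr 1
    push_cast
    ring
  · have hs3 : Summable fun n : ℤ => (q ^ 2) ^ ((n + 1) ^ 2) :=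
      hs2.comp_injective (add_left_injective 1)
    have hshift : ∑' n : ℤ, (q ^ 2) ^ (n ^ 2) = ∑' n : ℤ, (q ^ 2) ^ ((n + 1) ^ 2) :=
      ((Equiv.addRight (1 : ℤ)).tsum_eq fun n : ℤ => (q ^ 2) ^ (n ^ 2)).symm
    rw [hshift, tsum_mul_tsum_eq_tsum_prod hs3 ho2]
    refine tsum_congr fun z => ?_
    simp only [← zpow_natCast q 2, ← zpow_mul, ← zpow_add₀ hq0]
    congr 1
    push_cast
    ring

theorem neg_zpow_sq (q : ℝ) (n : ℤ) : (-q) ^ (n ^ 2) = (-1) ^ n * q ^ (n ^ 2) := by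
  rw [← neg_one_mul, mul_zpow]
  congr 1
  rcases n.even_or_odd with h | h
  · rw [h.neg_one_zpow, (h.pow_of_ne_zero two_ne_zero).neg_one_zpow]
  · rw [h.neg_one_zpow, h.pow.neg_one_zpow]

theorem tsum_neg_one_zpow_mul_oblong (q : ℝ) :
    ∑' n : ℤ, (-1) ^ n * q ^ (n * (n + 1)) = 0 := by
  have h := (Equiv.subLeft (-1 : ℤ)).tsum_eq fun n : ℤ => (-1 : ℝ) ^ n * q ^ (n * (n + 1))
  have h2 : ∀ n : ℤ, (-1 : ℝ) ^ (Equiv.subLeft (-1 : ℤ) n) *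
      q ^ (Equiv.subLeft (-1 : ℤ) n * (Equiv.subLeft (-1 : ℤ) n + 1)) =
      -((-1) ^ n * q ^ (n * (n + 1))) := fun n => by
    rw [Equiv.subLeft_apply, zpow_sub₀ (by norm_num), ← neg_mul]
    congr 1
    · rcases n.even_or_odd with h | h <;> simp [h.neg_one_zpow]
    · congr 1; ring
  simp only [h2, tsum_neg] at h
  linarith

theorem phi_mul_phi_neg (hq0 : q ≠ 0) (hq : |q| < 1) :
    phi q * phi (-q) = phi (-q ^ 2) ^ 2 := by
  have hs := summable_zpow_sq hq0 hq
  have hs' : Summable fun n : ℤ => (-1) ^ n * q ^ (n ^ 2) := by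
    simpa only [neg_zpow_sq] using summable_zpow_sq (neg_ne_zero.2 hq0) (by rwa [abs_neg])
  have hs2 : Summable fun n : ℤ => (-1) ^ n * (q ^ 2) ^ (n ^ 2) := by
    simpa only [neg_zpow_sq] using summable_zpow_sq (neg_ne_zero.2 (pow_ne_zero 2 hq0))
      (by rw [abs_neg]; exact abs_sq_lt_one hq)
  have ho2 : Summable fun n : ℤ => (-1) ^ n * (q ^ 2) ^ (n * (n + 1)) := by
    refine (summable_zpow_mul_add_one (pow_ne_zero 2 hq0)
      (abs_sq_lt_one hq)).norm.of_norm_bounded fun n => ?_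
    simp
  have hsign : ∀ z : ℤ × ℤ, (-1 : ℝ) ^ (z.1 - z.2) = (-1) ^ z.1 * (-1) ^ z.2 := fun z => by
    rw [zpow_sub₀ (by norm_num), div_eq_mul_inv, ← inv_zpow]
    norm_num
  simp only [phi_eq_tsum_zpow, neg_zpow_sq, sq (∑' _, _)]
  rw [tsum_mul_tsum_eq_add hs hs', tsum_mul_tsum_eq_tsum_prod hs2 hs2]
  refine (congrArg₂ (· + ·) ?_ ?_).trans (add_zero _)
  · refine tsum_congr fun z => ?_
    rw [hsign, mul_mul_mul_comm, mul_left_comm]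
    simp only [← zpow_natCast q 2, ← zpow_mul, ← zpow_add₀ hq0]
    congr 2
    push_cast
    ring
  · trans ∑' z : ℤ × ℤ, q * (((-1) ^ z.1 * (q ^ 2) ^ (z.1 * (z.1 + 1))) *
      ((-1) ^ z.2 * (q ^ 2) ^ (z.2 * (z.2 + 1))))
    · refine tsum_congr fun z => ?_
      rw [hsign, mul_mul_mul_comm, mul_left_comm, mul_left_comm q]
      simp only [← zpow_natCast q 2, ← zpow_mul, ← zpow_add₀ hq0, ← zpow_one_add₀ hq0]
      congr 2
      push_cast
      ring
    · rw [tsum_mul_left, ← tsum_mul_tsum_eq_tsum_prod ho2 ho2, tsum_neg_one_zpow_mul_oblong]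
      simp

theorem phi_neg_sq_eq_sub (hq0 : q ≠ 0) (hq : |q| < 1) :
    phi (-q) ^ 2 = phi (q ^ 2) ^ 2 - q * oblongTheta (q ^ 2) ^ 2 := by
  rw [phi_sq_eq_add (neg_ne_zero.2 hq0) (by rwa [abs_neg]), neg_sq, neg_mul, sub_eq_add_neg]

/-- Jacobi's quartic identity. -/
theorem phi_pow_four_sub (hq0 : q ≠ 0) (hq : |q| < 1) :
    phi q ^ 4 - phi (-q) ^ 4 = q * oblongTheta q ^ 4 := by
  linear_combination (phi q ^ 2 + phi (q ^ 2) ^ 2 + q * oblongTheta (q ^ 2) ^ 2)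
    * phi_sq_eq_add hq0 hq - (phi (-q) ^ 2 + phi (q ^ 2) ^ 2 - q * oblongTheta (q ^ 2) ^ 2)
    * phi_neg_sq_eq_sub hq0 hq - q * (oblongTheta q ^ 2 + 2 * (phi (q ^ 2) * oblongTheta (q ^ 2)))
    * oblongTheta_sq hq0 hq

theorem phi_pos (hq0 : 0 < q) (hq1 : q < 1) : 0 < phi q := by
  rw [phi_eq_tsum_zpow]
  exact (summable_zpow_sq hq0.ne' (by rwa [abs_of_pos hq0])).tsum_pos
    (fun n => by positivity) 0 (by simp)

theorem oblongTheta_pos (hq0 : 0 < q) (hq1 : q < 1) : 0 < oblongTheta q :=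
  (summable_zpow_mul_add_one hq0.ne' (by rwa [abs_of_pos hq0])).tsum_pos
    (fun n => by positivity) 0 (by simp)

theorem phi_zero : phi 0 = 1 := by
  unfold phi
  rw [tsum_eq_single 0 fun n hn => by simp [hn]]
  simp

theorem continuousAt_phi (hq : |q| < 1) : ContinuousAt phi q := by
  obtain ⟨r, hqr, hr⟩ := exists_between hq
  have hr0 : 0 ≤ r := (abs_nonneg q).trans hqr.le
  have h : ContinuousOn phi (Set.Ioo (-r) r) := by
    refine continuousOn_tsum (fun n => (continuous_pow _).continuousOn) (summable_pow_natAbs hr0 hr)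
      fun n y hy => ?_
    rw [norm_pow, Real.norm_eq_abs]
    refine (pow_le_pow_left₀ (abs_nonneg y) (abs_lt.2 hy).le _).trans ?_
    exact pow_le_pow_of_le_one hr0 hr.le (Nat.le_self_pow two_ne_zero _)
  exact h.continuousAt (isOpen_Ioo.mem_nhds (abs_lt.1 hqr))

end

theorem exp_zpow_eq (s : ℝ) (k : ℤ) : exp (-π * s) ^ k = exp (-π * s * k) := by
  rw [← Real.rpow_intCast, ← Real.exp_mul]

theorem phi_exp_inv {s : ℝ} (hs : 0 < s) :
    phi (exp (-π * (1 / s))) ^ 2 = s * phi (exp (-π * s)) ^ 2 := by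
  have h := Real.tsum_exp_neg_mul_int_sq hs
  have h1 : phi (exp (-π * s)) = 1 / √s * phi (exp (-π * (1 / s))) := by
    rw [Real.sqrt_eq_rpow]
    simp only [phi_eq_tsum_zpow, exp_zpow_eq]
    push_cast
    rw [h]
    simp only [mul_one_div]
  rw [h1, mul_pow, div_pow, Real.sq_sqrt hs.le]
  field_simp

theorem phi_neg_exp {s : ℝ} (hs : 0 < s) :
    phi (-exp (-π * s)) =
      1 / √s * (exp (-π * (1 / s) / 4) * oblongTheta (exp (-π * (1 / s)))) := by
  have h := Complex.tsum_exp_neg_quadratic (a := s) (by simpa using hs) (-Complex.I / 2)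
  rw [Real.sqrt_eq_rpow, phi_eq_tsum_zpow, oblongTheta, ← tsum_mul_left, ← Complex.ofReal_inj]
  push_cast
  rw [Complex.ofReal_cpow hs.le]
  push_cast
  convert h using 1
  · refine tsum_congr fun n => ?_
    have h1 : (-exp (-π * s)) ^ (n ^ 2) = (-1) ^ n * exp (-π * s * ((n ^ 2 : ℤ) : ℝ)) := by
      rw [neg_zpow_sq, exp_zpow_eq]
    have h2 : ((-1 : ℂ)) ^ n = Complex.exp (2 * π * (-Complex.I / 2) * n) := by
      rw [mul_comm _ (n : ℂ), Complex.exp_int_mul]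
      congr 1
      rw [show 2 * (π : ℂ) * (-Complex.I / 2) = -(π * Complex.I) by ring, Complex.exp_neg,
        Complex.exp_pi_mul_I]
      norm_num
    have h3 := congrArg Complex.ofReal h1
    push_cast at h3
    rw [h3, h2, ← Complex.exp_add]
    congr 1
    ring
  · congr 1
    refine tsum_congr fun n => ?_
    rw [← Complex.exp_int_mul, ← Complex.exp_add]
    congr 1
    push_cast
    linear_combination (-(π : ℂ) / s) * (n + (1 - Complex.I ^ 2) / 4) * Complex.I_sq

/-- The modulus `1 - φ(-q)⁴ / φ(q)⁴` attached to the nome `q`. -/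
noncomputable def thetaModulus (q : ℝ) : ℝ := 1 - phi (-q) ^ 4 / phi q ^ 4

theorem exists_eq_exp_neg_pi_mul {q : ℝ} (hq0 : 0 < q) (hq1 : q < 1) :
    ∃ s, 0 < s ∧ q = exp (-π * s) := by
  refine ⟨-log q / π, div_pos (neg_pos.2 (log_neg hq0 hq1)) pi_pos, ?_⟩
  rw [show -π * (-log q / π) = log q by field_simp, exp_log hq0]

theorem exp_neg_pi_mul_lt_one {s : ℝ} (hs : 0 < s) : exp (-π * s) < 1 := by
  rw [exp_lt_one_iff]
  nlinarith [mul_pos pi_pos hs]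

theorem phi_neg_pos {q : ℝ} (hq0 : 0 < q) (hq1 : q < 1) : 0 < phi (-q) := by
  obtain ⟨s, hs, rfl⟩ := exists_eq_exp_neg_pi_mul hq0 hq1
  rw [phi_neg_exp hs]
  have := oblongTheta_pos (exp_pos _) (exp_neg_pi_mul_lt_one (one_div_pos.2 hs))
  positivity

theorem thetaModulus_zero : thetaModulus 0 = 0 := by simp [thetaModulus, phi_zero]

theorem continuousAt_thetaModulus {q : ℝ} (hq0 : 0 ≤ q) (hq1 : q < 1) :
    ContinuousAt thetaModulus q := by
  have hq : |q| < 1 := by rwa [abs_of_nonneg hq0]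
  have h1 := continuousAt_phi hq
  have h2 : ContinuousAt (fun y => phi (-y)) q :=
    ContinuousAt.comp (f := fun y : ℝ => -y) (continuousAt_phi (by rwa [abs_neg]))
      continuous_neg.continuousAt
  have h0 : phi q ≠ 0 := by
    rcases hq0.eq_or_lt with rfl | hq0
    · simp [phi_zero]
    · exact (phi_pos hq0 hq1).ne'
  exact continuousAt_const.sub ((h2.pow 4).div (h1.pow 4) (pow_ne_zero 4 h0))

/-- The imaginary transformation complements the modulus. -/
theorem thetaModulus_exp_inv {s : ℝ} (hs : 0 < s) :
    thetaModulus (exp (-π * (1 / s))) = 1 - thetaModulus (exp (-π * s)) := by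
  have hs' := one_div_pos.2 hs
  have hq1 := exp_neg_pi_mul_lt_one hs'
  have hj := phi_pow_four_sub (exp_pos (-π * (1 / s))).ne' (by rwa [abs_of_pos (exp_pos _)])
  have h1 : phi (exp (-π * (1 / s))) ^ 4 = s ^ 2 * phi (exp (-π * s)) ^ 4 := by
    linear_combination (phi (exp (-π * (1 / s))) ^ 2 + s * phi (exp (-π * s)) ^ 2) * phi_exp_inv hs
  have h2 : s ^ 2 * phi (-exp (-π * s)) ^ 4
      = exp (-π * (1 / s)) * oblongTheta (exp (-π * (1 / s))) ^ 4 := by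
    have h3 : √s ^ 4 = s ^ 2 := by rw [show 4 = 2 * 2 from rfl, pow_mul, sq_sqrt hs.le]
    have h4 : exp (-π * (1 / s) / 4) ^ 4 = exp (-π * (1 / s)) := by
      rw [← exp_nat_mul]
      congr 1
      push_cast
      ring
    rw [phi_neg_exp hs, mul_pow, mul_pow, div_pow, h3, h4]
    field_simp
  have hp := phi_pos (exp_pos (-π * s)) (exp_neg_pi_mul_lt_one hs)
  rw [thetaModulus, thetaModulus, sub_sub_cancel, h1,
    ← mul_div_mul_left _ (_ ^ 4) (pow_ne_zero 2 hs.ne'), h2, ← hj, h1, sub_div, div_self (by positivity)]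

theorem ellipticZ_thetaModulus_div_sq {q : ℝ} (hq0 : 0 < q) (hq1 : q < 1) :
    ellipticZ (thetaModulus q) / phi q ^ 2
      = ellipticZ (thetaModulus (q ^ 2)) / phi (q ^ 2) ^ 2 := by
  have hq : |q| < 1 := by rwa [abs_of_pos hq0]
  have ha := phi_pos hq0 hq1
  have hb := phi_neg_pos hq0 hq1
  have hc := phi_pos (pow_pos hq0 2) (pow_lt_one₀ hq0.le hq1 two_ne_zero)
  have hA := phi_sq_eq_add hq0.ne' hq
  have hB := phi_neg_sq_eq_sub hq0.ne' hq
  have hC := phi_mul_phi_neg hq0.ne' hq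
  have hle : phi (-q) ^ 2 ≤ phi q ^ 2 := by
    have : 0 ≤ q * oblongTheta (q ^ 2) ^ 2 := by positivity
    linarith
  have hsum : phi (q ^ 2) ^ 2 = (phi q ^ 2 + phi (-q) ^ 2) / 2 := by linarith
  have hprod : phi (-q ^ 2) ^ 4 = phi q ^ 2 * phi (-q) ^ 2 := by
    linear_combination -(phi q * phi (-q) + phi (-q ^ 2) ^ 2) * hC
  have hsum4 : phi (q ^ 2) ^ 4 = ((phi q ^ 2 + phi (-q) ^ 2) / 2) ^ 2 := by
    rw [← hsum]; ring
  have hL := ellipticZ_landen (t := (phi q ^ 2 - phi (-q) ^ 2) / (phi q ^ 2 + phi (-q) ^ 2))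
    (div_nonneg (sub_nonneg.2 hle) (by positivity))
    ((div_lt_one (by positivity)).2 (by nlinarith [pow_pos hb 2]))
  have e1 : 4 * ((phi q ^ 2 - phi (-q) ^ 2) / (phi q ^ 2 + phi (-q) ^ 2))
      / (1 + (phi q ^ 2 - phi (-q) ^ 2) / (phi q ^ 2 + phi (-q) ^ 2)) ^ 2 = thetaModulus q := by
    rw [one_add_div (by positivity), thetaModulus,
      show phi q ^ 2 + phi (-q) ^ 2 + (phi q ^ 2 - phi (-q) ^ 2) = 2 * phi q ^ 2 by ring]
    field_simp
    ring
  have e2 : ((phi q ^ 2 - phi (-q) ^ 2) / (phi q ^ 2 + phi (-q) ^ 2)) ^ 2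
      = thetaModulus (q ^ 2) := by
    rw [thetaModulus, hprod, hsum4]
    field_simp
    ring
  rw [e1, e2] at hL
  rw [hL, hsum, one_add_div (by positivity)]
  field_simp
  ring

/-- The inversion formula `z(x(q)) = φ(q)²`. -/
theorem ellipticZ_thetaModulus {q : ℝ} (hq0 : 0 < q) (hq1 : q < 1) :
    ellipticZ (thetaModulus q) = phi q ^ 2 := by
  set g : ℝ → ℝ := fun y => ellipticZ (thetaModulus y) / phi y ^ 2 with hg
  have hiter : ∀ n : ℕ, g (q ^ 2 ^ n) = g q := fun n => by
    induction n with
    | zero => simp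
    | succ n ih =>
      rw [← ih, pow_succ, pow_mul]
      exact (ellipticZ_thetaModulus_div_sq (pow_pos hq0 _)
        (pow_lt_one₀ hq0.le hq1 (by positivity))).symm
  have hcont : ContinuousAt g 0 := by
    have h1 : ContinuousAt ellipticZ (thetaModulus 0) := by
      rw [thetaModulus_zero]
      exact (hasDerivAt_ellipticZ (by simp)).continuousAt
    exact (ContinuousAt.comp h1 (continuousAt_thetaModulus le_rfl one_pos)).div
      ((continuousAt_phi (by simp)).pow 2) (by simp [phi_zero])
  have hlim : Filter.Tendsto (fun n : ℕ => q ^ 2 ^ n) Filter.atTop (nhds 0) :=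
    (tendsto_pow_atTop_nhds_zero_of_lt_one hq0.le hq1).comp
      (tendsto_pow_atTop_atTop_of_one_lt one_lt_two)
  have h := hcont.tendsto.comp hlim
  have h0 : g 0 = 1 := by simp [hg, thetaModulus_zero, ellipticZ_zero, phi_zero]
  have h2 : g q = 1 := by
    rw [← h0]
    refine tendsto_nhds_unique ?_ h
    simp only [Function.comp_def, hiter]
    exact tendsto_const_nhds
  exact (div_eq_one_iff_eq (pow_pos (phi_pos hq0 hq1) 2).ne').1 h2

theorem exists_thetaModulus_eq {x : ℝ} (hx0 : 0 < x) (hx1 : x < 1) :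
    ∃ q, 0 < q ∧ q < 1 ∧ thetaModulus q = x := by
  have hsmall : ∃ q, 0 < q ∧ q < 1 ∧ thetaModulus q < 1 - x := by
    have h := (continuousAt_thetaModulus le_rfl one_pos).eventually_lt_const
      (by rw [thetaModulus_zero]; linarith : thetaModulus 0 < 1 - x)
    have h2 := (h.filter_mono nhdsWithin_le_nhds).and (Ioo_mem_nhdsGT (one_pos (α := ℝ)))
    obtain ⟨q, hq, hq01⟩ := h2.exists
    exact ⟨q, hq01.1, hq01.2, hq⟩
  obtain ⟨q₀, h0, h1, hq₀⟩ := hsmall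
  obtain ⟨s, hs, rfl⟩ := exists_eq_exp_neg_pi_mul h0 h1
  have hs1 := exp_neg_pi_mul_lt_one (one_div_pos.2 hs)
  have hlarge : x ≤ thetaModulus (exp (-π * (1 / s))) := by
    rw [thetaModulus_exp_inv hs]
    linarith
  obtain ⟨q, hq, hqx⟩ := intermediate_value_Icc (exp_pos (-π * (1 / s))).le
    (fun y hy => (continuousAt_thetaModulus hy.1 (hy.2.trans_lt hs1)).continuousWithinAt)
    ⟨by rw [thetaModulus_zero]; exact hx0.le, hlarge⟩
  refine ⟨q, hq.1.lt_of_ne ?_, hq.2.trans_lt hs1, hqx⟩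
  rintro rfl
  rw [thetaModulus_zero] at hqx
  exact hx0.ne hqx

theorem z_eq_phi_sq (x : ℝ) (hx0 : 0 < x) (hx1 : x < 1) :
    hyp2F1 (1/2) (1/2) 1 x =
      (phi (Real.exp (-π * hyp2F1 (1/2) (1/2) 1 (1 - x) / hyp2F1 (1/2) (1/2) 1 x))) ^ 2 := by
  obtain ⟨q, hq0, hq1, rfl⟩ := exists_thetaModulus_eq hx0 hx1
  obtain ⟨s, hs, rfl⟩ := exists_eq_exp_neg_pi_mul hq0 hq1
  have hp := phi_pos hq0 hq1
  rw [hyp2F1_half_half_one, hyp2F1_half_half_one, ← thetaModulus_exp_inv hs,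
    ellipticZ_thetaModulus hq0 hq1, ellipticZ_thetaModulus (exp_pos _)
      (exp_neg_pi_mul_lt_one (one_div_pos.2 hs)), phi_exp_inv hs, ← mul_assoc,
    mul_div_cancel_right₀ _ (pow_pos hp 2).ne']
end
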